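/- (Combinatorial Period Theorem.) Let k₀, …, kₙ ∈ {0,1,2,3} and write σ_{k₀}σ_{k₁}⋯σ_{kₙ}·(1,0)ᵀ = (a+bφ, c+dφ)ᵀ with a, b, c, d natural numbers (such a, b, c, d exist and are unique since φ is irrational). Then the word r_{k₀}∘r_{k₁}∘⋯∘r_{kₙ}(1²2¹), the cutting sequence of the short periodic trajectory in this direction, has length 2(a+b+c+d), and the word r_{k₀}∘r_{k₁}∘⋯∘r_{kₙ}(3⁴4³), the cutting sequence of the long periodic trajectory in this direction, has length 2(a+2b+c+2d). -/

import Mathlib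

noncomputable section
open Matrix

noncomputable def φ : ℝ := (1 + Real.sqrt 5) / 2

noncomputable def σ : Fin 4 → Matrix (Fin 2) (Fin 2) ℝ
  | 0 => !![1, φ; 0, 1]
  | 1 => !![φ, φ; 1, φ]
  | 2 => !![φ, 1; φ, φ]
  | 3 => !![1, 0; φ, 1]

inductive B : Type
  | l12 | l21 | l23 | l32 | l34 | l43 | l45 | l54
  deriving DecidableEq, BEq, Repr

open B

/-- The substitutions r₀, r₁, r₂, r₃ on the 8-letter alphabet B,
where `l12` denotes the letter 1², etc. -/
def r : Fin 4 → B → List B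
  | 0, l12 => [l21]
  | 0, l21 => [l12]
  | 0, l23 => [l12, l23, l34]
  | 0, l32 => [l43, l32, l21]
  | 0, l34 => [l43]
  | 0, l43 => [l34]
  | 0, l45 => [l34, l45]
  | 0, l54 => [l54, l43]
  | 1, l12 => [l34, l45]
  | 1, l21 => [l54, l43]
  | 1, l23 => [l54, l43, l32, l21]
  | 1, l32 => [l12, l23, l34, l45]
  | 1, l34 => [l12, l23, l34]
  | 1, l43 => [l43, l32, l21]
  | 1, l45 => [l43, l32]
  | 1, l54 => [l23, l34]
  | 2, l12 => [l43, l32]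
  | 2, l21 => [l23, l34]
  | 2, l23 => [l23, l34, l45]
  | 2, l32 => [l54, l43, l32]
  | 2, l34 => [l54, l43, l32, l21]
  | 2, l43 => [l12, l23, l34, l45]
  | 2, l45 => [l12, l23]
  | 2, l54 => [l32, l21]
  | 3, l12 => [l12, l23]
  | 3, l21 => [l32, l21]
  | 3, l23 => [l32]
  | 3, l32 => [l23]
  | 3, l34 => [l23, l34, l45]
  | 3, l43 => [l54, l43, l32]
  | 3, l45 => [l54]
  | 3, l54 => [l45]

/-- Applying the substitution rᵢ letter by letter to a word. -/
def subst (i : Fin 4) (w : List B) : List B := (w.map (r i)).flatten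

/-- a_τ : number of letters in {1², 2¹}. -/
def na (w : List B) : ℕ := w.count l12 + w.count l21
/-- d_τ : number of letters in {2³, 3²}. -/
def nd (w : List B) : ℕ := w.count l23 + w.count l32
/-- b_τ : number of letters in {3⁴, 4³}. -/
def nb (w : List B) : ℕ := w.count l34 + w.count l43
/-- c_τ : number of letters in {4⁵, 5⁴}. -/
def nc (w : List B) : ℕ := w.count l45 + w.count l54

theorem cnt_append (u v : List B) : na (u ++ v) = na u + na v ∧ nb (u ++ v) = nb u + nb v ∧
    nc (u ++ v) = nc u + nc v ∧ nd (u ++ v) = nd u + nd v := by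
  simp only [na, nb, nc, nd, List.count_append]
  omega

theorem subst_cons (i : Fin 4) (x : B) (w : List B) : subst i (x :: w) = r i x ++ subst i w := by
  simp [subst]

theorem len_eq (w : List B) : w.length = na w + nb w + nc w + nd w := by
  induction w with
  | nil => rfl
  | cons x w ih =>
    have h := cnt_append [x] w
    rw [List.singleton_append] at h
    have h1 : na [x] + nb [x] + nc [x] + nd [x] = 1 := by cases x <;> rfl
    rw [List.length_cons]
    omega

/-- The linear action on counts. -/
def act (i : Fin 4) (a b c d : ℕ) : ℕ × ℕ × ℕ × ℕ :=
  match i with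
  | 0 => (a + d, b + c + d, c, d)
  | 1 => (b + d, a + b + c + d, a + d, b + c + d)
  | 2 => (b + c, a + b + d, b + d, a + b + c + d)
  | 3 => (a, b, b + c, a + b + d)

theorem cnt_subst (i : Fin 4) (w : List B) :
    (na (subst i w), nb (subst i w), nc (subst i w), nd (subst i w))
      = act i (na w) (nb w) (nc w) (nd w) := by
  induction w with
  | nil => fin_cases i <;> rfl
  | cons x w ih =>
    have h := cnt_append [x] w
    rw [List.singleton_append] at h
    have h2 := cnt_append (r i x) (subst i w)
    rw [← subst_cons] at h2
    have h3 : (na (r i x), nb (r i x), nc (r i x), nd (r i x))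
      = act i (na [x]) (nb [x]) (nc [x]) (nd [x]) := by
      fin_cases i <;> cases x <;> rfl
    fin_cases i <;> simp only [act, Prod.mk.injEq] at * <;> omega

theorem phi_sq : φ * φ = φ + 1 := by
  have := Real.goldenRatio_sq
  rw [pow_two] at this
  exact this

theorem phi_irr : Irrational φ := Real.goldenRatio_irrational

theorem phi_unique (a b a' b' : ℕ) (h : (a : ℝ) + b * φ = a' + b' * φ) : a = a' ∧ b = b' := by
  have hb : b = b' := by
    by_contra hne
    have hne' : ((b : ℝ) - b') ≠ 0 := by
      rw [sub_ne_zero]; exact_mod_cast hne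
    apply phi_irr
    refine ⟨((a' : ℚ) - a) / (b - b'), ?_⟩
    push_cast
    rw [div_eq_iff hne']
    linarith
  subst hb
  refine ⟨?_, rfl⟩
  have : (a : ℝ) = a' := by linarith
  exact_mod_cast this

theorem key (ks : List (Fin 4)) : ∃ a b c d : ℕ,
    ((ks.map σ).prod).mulVec ![1, 0] = ![(a : ℝ) + b * φ, (c : ℝ) + d * φ] ∧
    (na (ks.foldr subst [l12, l21]) = 2 * a ∧ nb (ks.foldr subst [l12, l21]) = 2 * b ∧
     nc (ks.foldr subst [l12, l21]) = 2 * c ∧ nd (ks.foldr subst [l12, l21]) = 2 * d) ∧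
    (na (ks.foldr subst [l34, l43]) = 2 * b ∧ nb (ks.foldr subst [l34, l43]) = 2 * (a + b) ∧
     nc (ks.foldr subst [l34, l43]) = 2 * d ∧ nd (ks.foldr subst [l34, l43]) = 2 * (c + d)) := by
  induction ks with
  | nil => 
    refine ⟨1, 0, 0, 0, ?_, ⟨rfl, rfl, rfl, rfl⟩, ⟨rfl, rfl, rfl, rfl⟩⟩
    simp
  | cons k ks ih =>
    obtain ⟨a, b, c, d, h, h1, h2⟩ := ih
    have e1 := cnt_subst k (ks.foldr subst [l12, l21])
    have e2 := cnt_subst k (ks.foldr subst [l34, l43])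
    simp only [List.foldr_cons, List.map_cons, List.prod_cons, ← Matrix.mulVec_mulVec, h]
    refine ⟨(act k a b c d).1, (act k a b c d).2.1, (act k a b c d).2.2.1,
      (act k a b c d).2.2.2, ?_, ?_, ?_⟩
    · have := phi_sq
      fin_cases k <;> ext j <;> fin_cases j <;>
        simp [act, σ, Matrix.mulVec, dotProduct, Fin.sum_univ_two] <;> grind
    · clear e2
      fin_cases k <;> simp only [act, Prod.mk.injEq] at * <;> omega
    · clear e1
      fin_cases k <;> simp only [act, Prod.mk.injEq] at * <;> omega

theorem stmt15 (ks : List (Fin 4)) (a b c d : ℕ)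
    (h : ((ks.map σ).prod).mulVec ![1, 0] = ![(a : ℝ) + b * φ, (c : ℝ) + d * φ]) :
    (ks.foldr subst [l12, l21]).length = 2 * (a + b + c + d) ∧
    (ks.foldr subst [l34, l43]).length = 2 * (a + 2 * b + c + 2 * d) := by
  obtain ⟨a', b', c', d', h', h1, h2⟩ := key ks
  rw [h'] at h
  have p := phi_unique a' b' a b (by simpa using congrFun h 0)
  have q := phi_unique c' d' c d (by simpa using congrFun h 1)
  rw [len_eq, len_eq]
  omega
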